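/- arXiv:2101.10459 — 5 statements merged into one kernel-verified Lean document; each statement's English description precedes it below -/
import Mathlib

section
/- Reduction to rank-1 projective measurements: let (ρ_x)_{x∈X} be d-dimensional quantum states and A a finite message alphabet. If for every finite family of rank-1 projective measurements {(Π_{b|y})_b}_{y∈Y} on ℂ^d the behavior p(b|x,y) = tr(Π_{b|y} ρ_x) admits a classical model with alphabet A, then for every finite family of arbitrary projective measurements on ℂ^d the generated behavior also admits a classical model with alphabet A. (This rests on the fact that every projective measurement on ℂ^d is a coarse graining—i.e., a deterministic post-processing—of some rank-1 projective measurement.) -/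
open Matrix BigOperators ComplexOrder

noncomputable section

/-- A behavior `p b x y` admits a classical model with message alphabet `A`:
there exist a finite set `Λ` (wlog `Fin n`), a probability distribution `pr` on it,
and conditional distributions `pa a x l` on `A` and `pb b a y l` on `B` such that
`p b x y = ∑ l, ∑ a, pr l * pa a x l * pb b a y l`. -/
def HasClassicalModel (A : Type) [Fintype A] {B X Y : Type} [Fintype B]
    (p : B → X → Y → ℝ) : Prop :=
  ∃ (n : ℕ) (pr : Fin n → ℝ) (pa : A → X → Fin n → ℝ) (pb : B → A → Y → Fin n → ℝ),
    (∀ l, 0 ≤ pr l) ∧ (∑ l, pr l = 1) ∧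
    (∀ a x l, 0 ≤ pa a x l) ∧ (∀ x l, ∑ a, pa a x l = 1) ∧
    (∀ b a y l, 0 ≤ pb b a y l) ∧ (∀ a y l, ∑ b, pb b a y l = 1) ∧
    (∀ b x y, p b x y = ∑ l, ∑ a, pr l * pa a x l * pb b a y l)

/-- A `d`-dimensional quantum state: positive semidefinite with trace 1. -/
def IsState {d : ℕ} (ρ : Matrix (Fin d) (Fin d) ℂ) : Prop :=
  ρ.PosSemidef ∧ ρ.trace = 1

/-- A POVM with outcome set `B`: positive semidefinite effects summing to the identity. -/
def IsPOVM {d : ℕ} {B : Type} [Fintype B] (M : B → Matrix (Fin d) (Fin d) ℂ) : Prop :=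
  (∀ b, (M b).PosSemidef) ∧ (∑ b, M b) = 1

/-- A projective measurement: orthogonal projections summing to the identity. -/
def IsProjMeasurement {d : ℕ} {B : Type} [Fintype B]
    (P : B → Matrix (Fin d) (Fin d) ℂ) : Prop :=
  (∀ b, (P b).IsHermitian) ∧ (∀ b, P b * P b = P b) ∧ (∑ b, P b) = 1

/-- A rank-1 projective measurement: a projective measurement whose projectors have trace 1. -/
def IsRankOneProjMeasurement {d : ℕ} {B : Type} [Fintype B]
    (P : B → Matrix (Fin d) (Fin d) ℂ) : Prop :=
  IsProjMeasurement P ∧ ∀ b, (P b).trace = 1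

/-- The POVM `N` is simulable by the finite collection of POVMs `M` with classical
pre- and post-processing. -/
def SimulableBy {d : ℕ} {B₂ Y₀ B₁ : Type} [Fintype B₂] [Fintype Y₀] [Fintype B₁]
    (N : B₂ → Matrix (Fin d) (Fin d) ℂ) (M : Y₀ → B₁ → Matrix (Fin d) (Fin d) ℂ) : Prop :=
  ∃ (q : Y₀ → ℝ) (r : B₂ → B₁ → Y₀ → ℝ),
    (∀ y, 0 ≤ q y) ∧ (∑ y, q y = 1) ∧
    (∀ b b' y, 0 ≤ r b b' y) ∧ (∀ b' y, ∑ b, r b b' y = 1) ∧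
    (∀ b, N b = ∑ y, ∑ b', (q y * r b b' y) • M y b')

/-- The effects of a projective measurement are mutually orthogonal. -/
theorem IsProjMeasurement.mul_eq_zero {d : ℕ} {B : Type} [Fintype B]
    {P : B → Matrix (Fin d) (Fin d) ℂ} (hP : IsProjMeasurement P) {b c : B} (hbc : c ≠ b) :
    P c * P b = 0 := by
  classical
  obtain ⟨hh, hi, hs⟩ := hP
  have key : ∀ e, (P e * P b)ᴴ * (P e * P b) = P b * P e * P b := fun e => by
    rw [conjTranspose_mul, (hh e).eq, (hh b).eq, Matrix.mul_assoc, ← Matrix.mul_assoc (P e),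
      hi, Matrix.mul_assoc]
  have hsum : ∑ e, P b * P e * P b = P b := by
    rw [← Finset.sum_mul, ← Finset.mul_sum, hs, Matrix.mul_one, hi]
  have hz : ∑ e ∈ Finset.univ.erase b, ((P e * P b)ᴴ * (P e * P b)).trace = 0 := by
    rw [← trace_sum]
    simp only [key]
    rw [← Finset.add_sum_erase _ _ (Finset.mem_univ b), hi, hi, add_eq_left] at hsum
    rw [hsum, trace_zero]
  have h0 := (Finset.sum_eq_zero_iff_of_nonneg
    (fun e _ => (posSemidef_conjTranspose_mul_self (P e * P b)).trace_nonneg)).1 hz c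
    (Finset.mem_erase.2 ⟨hbc, Finset.mem_univ c⟩)
  exact trace_conjTranspose_mul_self_eq_zero_iff.1 h0

/-- The orthonormal basis given by the columns of a unitary matrix defines a rank-one projective
measurement. -/
theorem isRankOneProjMeasurement_unitary {d : ℕ} {U : Matrix (Fin d) (Fin d) ℂ}
    (hU : Uᴴ * U = 1) :
    IsRankOneProjMeasurement fun i : Fin d => U * single i i 1 * Uᴴ := by
  have hU' : U * Uᴴ = 1 := mul_eq_one_comm.1 hU
  refine ⟨⟨fun i => ?_, fun i => ?_, ?_⟩, fun i => ?_⟩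
  · simp [IsHermitian, Matrix.mul_assoc]
  · calc U * single i i 1 * Uᴴ * (U * single i i 1 * Uᴴ)
        = U * single i i 1 * (Uᴴ * U) * single i i 1 * Uᴴ := by simp only [Matrix.mul_assoc]
      _ = U * single i i 1 * Uᴴ := by
        rw [hU, Matrix.mul_one, Matrix.mul_assoc U, single_mul_single_same, one_mul]
  · rw [← Finset.sum_mul, ← Finset.mul_sum, ← hU']
    have : ∑ i : Fin d, single i i (1 : ℂ) = 1 := by
      ext j k
      simp [Matrix.sum_apply, single_apply, one_apply, ite_and]
    rw [this, Matrix.mul_one]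
  · rw [trace_mul_comm, ← Matrix.mul_assoc, hU, Matrix.one_mul, trace_single_eq_same]

/-- Every projective measurement is simultaneously diagonalized by a unitary matrix. -/
theorem IsProjMeasurement.exists_unitary {d n : ℕ}
    {Q : Fin n → Matrix (Fin d) (Fin d) ℂ} (hQ : IsProjMeasurement Q) :
    ∃ (U : Matrix (Fin d) (Fin d) ℂ) (f : Fin d → Fin n), Uᴴ * U = 1 ∧
      ∀ b, Q b * U = U * diagonal fun j => if f j = b then 1 else 0 := by
  have hH : (∑ b : Fin n, ((b : ℕ) : ℂ) • Q b).IsHermitian := by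
    simp only [IsHermitian, conjTranspose_sum, conjTranspose_smul, (hQ.1 _).eq, star_natCast]
  set H := ∑ b : Fin n, ((b : ℕ) : ℂ) • Q b with hHdef
  set U : Matrix (Fin d) (Fin d) ℂ := hH.eigenvectorUnitary.1
  have hU : Uᴴ * U = 1 := mem_unitaryGroup_iff'.1 hH.eigenvectorUnitary.2
  have hHU : H * U = U * diagonal (fun j => (hH.eigenvalues j : ℂ)) := by
    conv_lhs => rw [hH.spectral_theorem]
    rw [Unitary.conjStarAlgAut_apply, Matrix.mul_assoc]
    erw [hU]
    rw [Matrix.mul_one]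
    rfl
  have hQH : ∀ b, Q b * H = ((b : ℕ) : ℂ) • Q b := fun b => by
    rw [hHdef, Finset.mul_sum, Finset.sum_eq_single b]
    · rw [Matrix.mul_smul, hQ.2.1]
    · intro c _ hc
      rw [Matrix.mul_smul, hQ.mul_eq_zero hc.symm, smul_zero]
    · simp
  have hev : ∀ b k j, (Q b * U) k j ≠ 0 → (hH.eigenvalues j : ℂ) = (b : ℕ) := fun b k j hne => by
    have h1 : ((b : ℕ) : ℂ) • (Q b * U) = Q b * U * diagonal (fun j => (hH.eigenvalues j : ℂ)) := by
      rw [Matrix.mul_assoc, ← hHU, ← Matrix.mul_assoc, hQH, Matrix.smul_mul]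
    have h2 := congrFun (congrFun h1 k) j
    rw [mul_diagonal, Matrix.smul_apply, smul_eq_mul, mul_comm] at h2
    exact (mul_left_cancel₀ hne h2).symm
  have hsum : ∀ k j, ∑ b, (Q b * U) k j = U k j := fun k j => by
    rw [← Matrix.sum_apply, ← Finset.sum_mul, hQ.2.2, Matrix.one_mul]
  have hex : ∀ j, ∃ b : Fin n, (hH.eigenvalues j : ℂ) = (b : ℕ) := fun j => by
    by_contra! hcon
    have hcol : ∀ k, U k j = 0 := fun k => by
      rw [← hsum]
      exact Finset.sum_eq_zero fun b _ => by_contra fun hne => hcon b (hev b k j hne)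
    have := congrFun (congrFun hU j) j
    simp [Matrix.mul_apply, hcol] at this
  choose f hf using hex
  have hzero : ∀ b k j, f j ≠ b → (Q b * U) k j = 0 := fun b k j hne => by
    by_contra hcon
    have := (hf j).symm.trans (hev b k j hcon)
    exact hne (Fin.ext (by exact_mod_cast this))
  refine ⟨U, f, hU, fun b => ?_⟩
  ext k j
  rw [mul_diagonal]
  split_ifs with hb
  · rw [mul_one, ← hsum, Finset.sum_eq_single b]
    · exact fun c _ hc => hzero c k j (by rw [hb]; exact hc.symm)
    · simp
  · rw [mul_zero, hzero b k j hb]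

/-- Every projective measurement is a coarse graining of a rank-one projective measurement. -/
theorem IsProjMeasurement.exists_rankOne_coarseGraining {d n : ℕ}
    {Q : Fin n → Matrix (Fin d) (Fin d) ℂ} (hQ : IsProjMeasurement Q) :
    ∃ (P : Fin d → Matrix (Fin d) (Fin d) ℂ) (f : Fin d → Fin n),
      IsRankOneProjMeasurement P ∧ ∀ b, Q b = ∑ j with f j = b, P j := by
  obtain ⟨U, f, hU, hd⟩ := hQ.exists_unitary
  have hU' : U * Uᴴ = 1 := mul_eq_one_comm.1 hU
  refine ⟨_, f, isRankOneProjMeasurement_unitary hU, fun b => ?_⟩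
  have hdiag : diagonal (fun j => if f j = b then (1 : ℂ) else 0)
      = ∑ j with f j = b, single j j 1 := by
    ext j k
    rw [Matrix.sum_apply, Finset.sum_filter]
    rw [Finset.sum_eq_single j (fun i _ hi => by simp [hi]) (by simp)]
    by_cases hjk : j = k <;> simp [hjk]
  rw [← Finset.sum_mul, ← Finset.mul_sum, ← hdiag, ← hd, Matrix.mul_assoc, hU', Matrix.mul_one]

/-- Classical models are stable under deterministic post-processing of the outcomes. -/
theorem HasClassicalModel.coarseGraining {A B B' X Y : Type} [Fintype A] [Fintype B] [Fintype B']
    [DecidableEq B'] {p : B → X → Y → ℝ} (hp : HasClassicalModel A p) (f : Y → B → B') :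
    HasClassicalModel A fun b' x y => ∑ b with f y b = b', p b x y := by
  obtain ⟨n, pr, pa, pb, h1, h2, h3, h4, h5, h6, h7⟩ := hp
  refine ⟨n, pr, pa, fun b' a y l => ∑ b with f y b = b', pb b a y l, h1, h2, h3, h4,
    fun b' a y l => Finset.sum_nonneg fun b _ => h5 b a y l, fun a y l => ?_, fun b' x y => ?_⟩
  · rw [← h6 a y l]
    exact Finset.sum_fiberwise _ _ _
  · simp only [h7, Finset.mul_sum]
    rw [Finset.sum_comm]
    exact Finset.sum_congr rfl fun l _ => Finset.sum_comm

/-- Reduction to rank-1 projective measurements: if the states `ρ_x`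
generate classical behaviors for every finite family of rank-1 projective measurements,
then they do so for every finite family of arbitrary projective measurements. -/
theorem classicality_for_rank_one_projective_implies_all_projective
    (d : ℕ) (hd : 1 ≤ d)
    (X A : Type) [Fintype X] [Fintype A] [Nonempty X] [Nonempty A]
    (ρ : X → Matrix (Fin d) (Fin d) ℂ) (hρ : ∀ x, IsState (ρ x))
    (h : ∀ (nY nB : ℕ) (P : Fin nY → Fin nB → Matrix (Fin d) (Fin d) ℂ),
      (∀ y, IsRankOneProjMeasurement (P y)) →
      HasClassicalModel A (fun b x y => (Matrix.trace (P y b * ρ x)).re)) :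
    ∀ (nY nB : ℕ) (Q : Fin nY → Fin nB → Matrix (Fin d) (Fin d) ℂ),
      (∀ y, IsProjMeasurement (Q y)) →
      HasClassicalModel A (fun b x y => (Matrix.trace (Q y b * ρ x)).re) := by
  intro nY nB Q hQ
  choose P f hP hPQ using fun y => (hQ y).exists_rankOne_coarseGraining
  convert (h nY d P hP).coarseGraining f using 4 with b x y
  rw [hPQ, Finset.sum_mul, trace_sum, Complex.re_sum]
end
end

section
/- Theorem 2 (preparation classicality for all POVMs): let d ≥ 2, n ≥ 1, t ∈ (0,1], and suppose that for every POVM (M_b)_{b} on ℂ^d with n outcomes, the depolarized POVM (Φ_t(M_b))_b is simulable by some finite collection of projective measurements with classical pre- and post-processing. Let (ρ_x)_{x∈X} be d-dimensional quantum states and define ρ'_x = (ρ_x − (1−t)·I_d/d)/t. If for every finite family of projective measurements on ℂ^d the probe behavior p(b|x,y) = tr(Π_{b|y} ρ'_x) admits a classical model with message alphabet A, then for every finite family of n-outcome POVMs (M_{b|y}) on ℂ^d, the behavior p(b|x,y) = tr(M_{b|y} ρ_x) admits a classical model with message alphabet A. -/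
open Matrix BigOperators ComplexOrder

noncomputable section

/-- The depolarizing map `Φ_t(A) = t•A + (1-t)•(tr A)•I_d/d` on `d × d` complex matrices. -/
def depolarize (d : ℕ) (t : ℝ) (M : Matrix (Fin d) (Fin d) ℂ) :
    Matrix (Fin d) (Fin d) ℂ :=
  t • M + ((1 - t) / (d : ℝ)) • M.trace • (1 : Matrix (Fin d) (Fin d) ℂ)

/-- Restricting or relabelling the measurements of a behavior preserves classicality. -/
theorem HasClassicalModel.reindex {A B X Y Y' : Type} [Fintype A] [Fintype B]
    {p : B → X → Y → ℝ} (h : HasClassicalModel A p) (f : Y' → Y) :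
    HasClassicalModel A (fun b x y => p b x (f y)) := by
  obtain ⟨n, pr, pa, pb, hpr, hpr1, hpa, hpa1, hpb, hpb1, hp⟩ := h
  exact ⟨n, pr, pa, fun b a y l => pb b a (f y) l, hpr, hpr1, hpa, hpa1,
    fun b a y l => hpb _ _ _ _, fun a y l => hpb1 _ _ _, fun b x y => hp _ _ _⟩

/-- Classical pre- and post-processing of the measurement side preserves classicality. -/
theorem HasClassicalModel.process {A B X Y B' Y' : Type} [Fintype A] [Fintype B] [Fintype Y]
    [Fintype B'] {p : B → X → Y → ℝ} (h : HasClassicalModel A p)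
    (w : Y' → Y → ℝ) (hw : ∀ y' y, 0 ≤ w y' y) (hw1 : ∀ y', ∑ y, w y' y = 1)
    (r : B' → B → Y → ℝ) (hr : ∀ b' b y, 0 ≤ r b' b y) (hr1 : ∀ b y, ∑ b', r b' b y = 1) :
    HasClassicalModel A (fun b' x y' => ∑ y, ∑ b, w y' y * r b' b y * p b x y) := by
  obtain ⟨n, pr, pa, pb, hpr, hpr1, hpa, hpa1, hpb, hpb1, hp⟩ := h
  refine ⟨n, pr, pa, fun b' a y' l => ∑ y, ∑ b, w y' y * r b' b y * pb b a y l,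
    hpr, hpr1, hpa, hpa1, fun b' a y' l => ?_, fun a y' l => ?_, fun b' x y' => ?_⟩
  · exact Finset.sum_nonneg fun y _ => Finset.sum_nonneg fun b _ =>
      mul_nonneg (mul_nonneg (hw _ _) (hr _ _ _)) (hpb _ _ _ _)
  · rw [Finset.sum_comm]
    have key : ∀ y, ∑ b', ∑ b, w y' y * r b' b y * pb b a y l = w y' y := by
      intro y
      rw [Finset.sum_comm]
      simp_rw [← Finset.sum_mul, ← Finset.mul_sum, hr1, mul_one]
      rw [← Finset.mul_sum, hpb1, mul_one]
    simp_rw [key, hw1]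
  · simp_rw [hp, Finset.mul_sum]
    calc _ = ∑ y, ∑ l, ∑ b, ∑ a, w y' y * r b' b y * (pr l * pa a x l * pb b a y l) :=
          Finset.sum_congr rfl fun y _ => Finset.sum_comm
      _ = ∑ l, ∑ y, ∑ b, ∑ a, w y' y * r b' b y * (pr l * pa a x l * pb b a y l) :=
          Finset.sum_comm
      _ = ∑ l, ∑ y, ∑ a, ∑ b, w y' y * r b' b y * (pr l * pa a x l * pb b a y l) :=
          Finset.sum_congr rfl fun l _ => Finset.sum_congr rfl fun y _ => Finset.sum_comm
      _ = ∑ l, ∑ a, ∑ y, ∑ b, w y' y * r b' b y * (pr l * pa a x l * pb b a y l) :=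
          Finset.sum_congr rfl fun l _ => Finset.sum_comm
      _ = _ := by
          refine Finset.sum_congr rfl fun l _ => Finset.sum_congr rfl fun a _ =>
            Finset.sum_congr rfl fun y _ => Finset.sum_congr rfl fun b _ => ?_
          ring

/-- Padding a projective measurement with zero effects gives a projective measurement. -/
theorem IsProjMeasurement.append_zero {d m : ℕ} {P : Fin m → Matrix (Fin d) (Fin d) ℂ}
    (hP : IsProjMeasurement P) (k : ℕ) :
    IsProjMeasurement (Fin.append P (0 : Fin k → Matrix (Fin d) (Fin d) ℂ)) := by
  obtain ⟨h1, h2, h3⟩ := hP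
  refine ⟨fun b => ?_, fun b => ?_, ?_⟩
  · induction b using Fin.addCases with
    | left i => simpa using h1 i
    | right i => simp
  · induction b using Fin.addCases with
    | left i => simpa using h2 i
    | right i => simp
  · simp [Fin.sum_univ_add, h3]

/-- Simulability is unaffected by padding the simulating measurements with zero effects. -/
theorem SimulableBy.append_zero {d m : ℕ} {B Y : Type} [Fintype B] [Nonempty B] [Fintype Y]
    {N : B → Matrix (Fin d) (Fin d) ℂ} {P : Y → Fin m → Matrix (Fin d) (Fin d) ℂ}
    (h : SimulableBy N P) (k : ℕ) :
    SimulableBy N (fun y => Fin.append (P y) (0 : Fin k → Matrix (Fin d) (Fin d) ℂ)) := by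
  classical
  obtain ⟨q, r, hq, hq1, hr, hr1, hN⟩ := h
  let b₀ : B := Classical.arbitrary B
  refine ⟨q, fun b b' y => Fin.append (fun i => r b i y)
    (fun _ : Fin k => if b = b₀ then 1 else 0) b', hq, hq1, fun b b' y => ?_, fun b' y => ?_,
    fun b => ?_⟩
  · induction b' using Fin.addCases with
    | left i => simpa using hr b i y
    | right i =>
      simp only [Fin.append_right]
      split_ifs <;> norm_num
  · induction b' using Fin.addCases with
    | left i => simpa using hr1 i y
    | right i => simp
  · simp [Fin.sum_univ_add, hN]

/-- Depolarizing the effect compensates for inflating the state. -/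
theorem trace_depolarize_mul {d : ℕ} (hd : d ≠ 0) {t : ℝ} (ht : t ≠ 0)
    {M ρ : Matrix (Fin d) (Fin d) ℂ} (hρ : ρ.trace = 1) :
    (depolarize d t M *
      (t⁻¹ • (ρ - ((1 - t) / (d : ℝ)) • (1 : Matrix (Fin d) (Fin d) ℂ)))).trace =
      (M * ρ).trace := by
  have hd' : (d : ℂ) ≠ 0 := Nat.cast_ne_zero.mpr hd
  have ht' : (t : ℂ) ≠ 0 := Complex.ofReal_ne_zero.mpr ht
  simp only [depolarize, add_mul, mul_sub, smul_mul_assoc, mul_smul_comm, one_mul, mul_one,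
    Matrix.trace_add, Matrix.trace_sub, Matrix.trace_smul, Matrix.trace_one, hρ, smul_sub,
    Fintype.card_fin, smul_eq_mul, Complex.real_smul]
  push_cast
  field_simp
  ring

/-- **Theorem 2 of the paper.** Preparation classicality for all POVMs.
Suppose every `n`-outcome POVM becomes projective-simulable after `t`-depolarization.
If the inflated states `ρ'_x = (ρ_x - (1-t)•I/d)/t` generate classical behaviors for
every finite family of projective measurements, then the states `ρ_x` generate classical
behaviors for every finite family of `n`-outcome POVMs. -/
theorem preparation_classicality_for_all_povms
    (d n : ℕ) (hd : 2 ≤ d) (hn : 1 ≤ n) (t : ℝ) (ht : t ∈ Set.Ioc (0 : ℝ) 1)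
    (X A : Type) [Fintype X] [Fintype A] [Nonempty X] [Nonempty A]
    (hsim : ∀ M : Fin n → Matrix (Fin d) (Fin d) ℂ, IsPOVM M →
      ∃ (nY nB : ℕ) (P : Fin nY → Fin nB → Matrix (Fin d) (Fin d) ℂ),
        (∀ y, IsProjMeasurement (P y)) ∧
        SimulableBy (fun b => depolarize d t (M b)) P)
    (ρ : X → Matrix (Fin d) (Fin d) ℂ) (hρ : ∀ x, IsState (ρ x))
    (ρ' : X → Matrix (Fin d) (Fin d) ℂ)
    (hρ' : ∀ x, ρ' x = t⁻¹ • (ρ x - ((1 - t) / (d : ℝ)) • (1 : Matrix (Fin d) (Fin d) ℂ)))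
    (hcl : ∀ (nY nB : ℕ) (P : Fin nY → Fin nB → Matrix (Fin d) (Fin d) ℂ),
      (∀ y, IsProjMeasurement (P y)) →
      HasClassicalModel A (fun b x y => (Matrix.trace (P y b * ρ' x)).re)) :
    ∀ (nY : ℕ) (M : Fin nY → Fin n → Matrix (Fin d) (Fin d) ℂ),
      (∀ y, IsPOVM (M y)) →
      HasClassicalModel A (fun b x y => (Matrix.trace (M y b * ρ x)).re) := by
  classical
  obtain ⟨ht0, -⟩ := ht
  have : Nonempty (Fin n) := ⟨⟨0, hn⟩⟩
  intro nY M hM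
  choose mY mB P hP hS using fun y => hsim (M y) (hM y)
  obtain ⟨K, hK⟩ : ∃ K, ∀ y, mB y ≤ K :=
    ⟨Finset.univ.sup mB, fun y => Finset.le_sup (Finset.mem_univ y)⟩
  have hpad : ∀ y, ∃ Q : Fin (mY y) → Fin K → Matrix (Fin d) (Fin d) ℂ,
      (∀ z, IsProjMeasurement (Q z)) ∧ SimulableBy (fun b => depolarize d t (M y b)) Q := by
    intro y
    obtain ⟨k, rfl⟩ := Nat.exists_eq_add_of_le (hK y)
    exact ⟨_, fun z => (hP y z).append_zero k, (hS y).append_zero k⟩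
  choose Q hQ q r hq hq1 hr hr1 hN using hpad
  let e := Fintype.equivFin (Σ y, Fin (mY y))
  have hprobe := (hcl _ K (fun i => Q (e.symm i).1 (e.symm i).2) fun i => hQ _ _).reindex e
  have hQe : ∀ s, Q (e.symm (e s)).1 (e.symm (e s)).2 = Q s.1 s.2 := fun s =>
    congrArg (fun s : (Σ y, Fin (mY y)) => Q s.1 s.2) (e.symm_apply_apply s)
  have hmodel := hprobe.process
    (fun (y : Fin nY) s => if s.1 = y then q s.1 s.2 else 0)
    (fun y s => by
      split_ifs
      exacts [hq _ _, le_rfl])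
    (fun y => by
      rw [Fintype.sum_sigma, Finset.sum_eq_single y]
      · simpa using hq1 y
      · intro z _ hz
        simp [hz]
      · simp)
    (fun b b' s => r s.1 b b' s.2) (fun b b' s => hr _ _ _ _) (fun b' s => hr1 _ _ _)
  convert hmodel using 1
  funext b x y
  rw [Fintype.sum_sigma, Finset.sum_eq_single y]
  · rw [← trace_depolarize_mul (by omega) ht0.ne' (hρ x).2, ← hρ' x]
    have h := hN y b
    dsimp only at h
    rw [h]
    simp [hQe, Finset.sum_mul, Matrix.trace_sum, Matrix.trace_smul, Complex.re_sum]
  · intro z _ hz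
    simp [hz]
  · simp
end
end

section
/- Theorem 3 (classicality of projective measurements for all preparations): let d ≥ 2, η ∈ (0,1], and let {(Π_{b|y})_b}_{y∈Y} be a finite collection of rank-1 projective measurements on ℂ^d. Define O_{b|y} = (Π_{b|y} − (1−η)·I_d/d)/η. Let (ρ_x)_{x∈X} be a finite collection of pure d-dimensional states (rank-1 projections of trace 1) such that for every pure state ψ on ℂ^d the depolarized state η·ψ + (1−η)·I_d/d lies in the convex hull of {ρ_x : x∈X}. If the probe behavior p(b|x,y) = tr(O_{b|y} ρ_x) admits a classical model with message alphabet A, then for every finite family (σ_z)_{z∈Z} of d-dimensional quantum states (pure or mixed), the behavior p(b|z,y) = tr(Π_{b|y} σ_z) admits a classical model with message alphabet A. -/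
open Matrix BigOperators ComplexOrder

noncomputable section

/-- A pure `d`-dimensional state: a rank-1 orthogonal projection (trace 1). -/
def IsPureState {d : ℕ} (ρ : Matrix (Fin d) (Fin d) ℂ) : Prop :=
  ρ.IsHermitian ∧ ρ * ρ = ρ ∧ ρ.trace = 1

/-- A behavior whose preparations are finite classical mixtures of the preparations of a behavior
with a classical model has a classical model with the same message alphabet. -/
theorem HasClassicalModel.of_mixture {A B X Y Z : Type} [Fintype A] [Fintype B]
    {p : B → X → Y → ℝ} (hp : HasClassicalModel A p) {q : B → Z → Y → ℝ}
    (hq : ∀ z, ∃ (ι : Type) (_ : Fintype ι) (w : ι → ℝ) (f : ι → X), (∀ i, 0 ≤ w i) ∧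
      ∑ i, w i = 1 ∧ ∀ b y, q b z y = ∑ i, w i * p b (f i) y) :
    HasClassicalModel A q := by
  obtain ⟨n, pr, pa, pb, hpr, hpr1, hpa, hpa1, hpb, hpb1, hp⟩ := hp
  choose ι _ w f hw hw1 hq using hq
  refine ⟨n, pr, fun a z l => ∑ i, w z i * pa a (f z i) l, pb, hpr, hpr1,
    fun a z l => Finset.sum_nonneg fun i _ => mul_nonneg (hw z i) (hpa _ _ _), fun z l => ?_,
    hpb, hpb1, fun b z y => ?_⟩
  · rw [Finset.sum_comm]
    simp [← Finset.mul_sum, hpa1, hw1]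
  · simp only [hq, hp, Finset.mul_sum, Finset.sum_mul]
    rw [Finset.sum_comm]
    refine Finset.sum_congr rfl fun l _ => ?_
    rw [Finset.sum_comm]
    exact Finset.sum_congr rfl fun a _ => Finset.sum_congr rfl fun i _ => by ring

/-- The conjugate of a diagonal matrix unit by a unitary matrix is a pure state. -/
theorem isPureState_conj_diagonal_single {d : ℕ} (U : Matrix.unitaryGroup (Fin d) ℂ) (i : Fin d) :
    IsPureState ((U : Matrix (Fin d) (Fin d) ℂ) * diagonal (Pi.single i 1) *
      star (U : Matrix (Fin d) (Fin d) ℂ)) := by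
  have hU : star (U : Matrix (Fin d) (Fin d) ℂ) * U = 1 := Unitary.coe_star_mul_self U
  refine ⟨?_, ?_, ?_⟩
  · rw [star_eq_conjTranspose]
    refine isHermitian_mul_mul_conjTranspose _ (isHermitian_diagonal_iff.2 fun j => ?_)
    by_cases h : j = i
    · subst h; simp
    · simp [h]
  · have hD : diagonal (Pi.single i (1 : ℂ)) * diagonal (Pi.single i 1) =
        diagonal (Pi.single i 1) := by
      rw [diagonal_mul_diagonal']
      exact congrArg diagonal (by rw [← Pi.mul_def, ← Pi.single_mul, one_mul])
    simp only [Matrix.mul_assoc]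
    rw [← Matrix.mul_assoc (star _) (U : Matrix (Fin d) (Fin d) ℂ), hU, Matrix.one_mul,
      ← Matrix.mul_assoc (diagonal _) (diagonal _), hD]
  · rw [Matrix.trace_mul_comm, ← Matrix.mul_assoc, hU, Matrix.one_mul, trace_diagonal]
    simp

/-- Every quantum state is a convex combination of pure states. -/
theorem IsState.exists_pure_decomposition {d : ℕ} {σ : Matrix (Fin d) (Fin d) ℂ}
    (hσ : IsState σ) :
    ∃ (w : Fin d → ℝ) (ψ : Fin d → Matrix (Fin d) (Fin d) ℂ), (∀ i, 0 ≤ w i) ∧ ∑ i, w i = 1 ∧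
      (∀ i, IsPureState (ψ i)) ∧ ∑ i, w i • ψ i = σ := by
  obtain ⟨hpos, htr⟩ := hσ
  have hH := hpos.isHermitian
  refine ⟨hH.eigenvalues, _, hpos.eigenvalues_nonneg, ?_,
    isPureState_conj_diagonal_single hH.eigenvectorUnitary, ?_⟩
  · rw [hH.trace_eq_sum_eigenvalues] at htr
    exact Complex.ofReal_injective (by simpa using htr)
  · conv_rhs => rw [hH.spectral_theorem, Unitary.conjStarAlgAut_apply]
    simp only [← Matrix.smul_mul, ← Matrix.sum_mul]
    congr 1
    ext j k
    simp [Matrix.sum_apply, Matrix.mul_diagonal, Pi.single_apply, mul_comm]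

/-- If the depolarized version of every pure state lies in a convex set, then so does the
depolarized version of every state. -/
theorem IsState.depolarized_mem {d : ℕ} {η c : ℝ} {s : Set (Matrix (Fin d) (Fin d) ℂ)}
    (hs : Convex ℝ s)
    (hpure : ∀ ψ : Matrix (Fin d) (Fin d) ℂ, IsPureState ψ →
      η • ψ + c • (1 : Matrix (Fin d) (Fin d) ℂ) ∈ s)
    {σ : Matrix (Fin d) (Fin d) ℂ} (hσ : IsState σ) :
    η • σ + c • (1 : Matrix (Fin d) (Fin d) ℂ) ∈ s := by
  obtain ⟨w, ψ, hw, hw1, hψ, rfl⟩ := hσ.exists_pure_decomposition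
  have h := hs.sum_mem (fun i _ => hw i) hw1 fun i _ => hpure (ψ i) (hψ i)
  convert h using 1
  simp only [smul_add, Finset.sum_add_distrib, ← Finset.sum_smul, hw1, one_smul, Finset.smul_sum]
  simp only [smul_comm η]

/-- The inverse depolarization of a trace-one effect, evaluated on a depolarized trace-one matrix,
returns the original expectation value. -/
theorem trace_inverse_depolarized_mul_depolarized {d : ℕ} (hd : d ≠ 0) {η : ℝ} (hη : η ≠ 0)
    {P σ : Matrix (Fin d) (Fin d) ℂ} (hP : P.trace = 1) (hσ : σ.trace = 1) :
    Matrix.trace ((η⁻¹ • (P - ((1 - η) / (d : ℝ)) • (1 : Matrix (Fin d) (Fin d) ℂ))) *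
      (η • σ + ((1 - η) / (d : ℝ)) • (1 : Matrix (Fin d) (Fin d) ℂ))) = Matrix.trace (P * σ) := by
  simp only [Matrix.smul_mul, Matrix.sub_mul, Matrix.mul_add, Matrix.mul_smul, Matrix.one_mul,
    Matrix.mul_one, Matrix.trace_smul, Matrix.trace_sub, Matrix.trace_add, Matrix.trace_one,
    hP, hσ, Complex.real_smul, Fintype.card_fin]
  have hd' : (d : ℂ) ≠ 0 := by exact_mod_cast hd
  have hη' : (η : ℂ) ≠ 0 := by exact_mod_cast hη
  push_cast
  field_simp
  ring

/-- **Theorem 3 of the paper.** Classicality of projective measurements for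
all preparations.  Let `Π` be rank-1 projective measurements, `O_{b|y} = (Π_{b|y} -
(1-η)•I/d)/η`, and let `ρ_x` be pure probe states whose convex hull contains every
`η`-depolarized pure state.  If the probe behavior `tr (O_{b|y} ρ_x)` admits a classical
model with alphabet `A`, then the measurements `Π` generate classical behaviors on every
finite family of (pure or mixed) quantum states. -/
theorem projective_measurement_classicality_for_all_preparations
    (d : ℕ) (hd : 2 ≤ d) (η : ℝ) (hη : η ∈ Set.Ioc (0 : ℝ) 1)
    (X A Y B : Type) [Fintype X] [Fintype A] [Fintype Y] [Fintype B]
    [Nonempty X] [Nonempty A] [Nonempty Y] [Nonempty B]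
    (Pi : Y → B → Matrix (Fin d) (Fin d) ℂ)
    (hPi : ∀ y, IsRankOneProjMeasurement (Pi y))
    (O : Y → B → Matrix (Fin d) (Fin d) ℂ)
    (hO : ∀ y b, O y b =
      η⁻¹ • (Pi y b - ((1 - η) / (d : ℝ)) • (1 : Matrix (Fin d) (Fin d) ℂ)))
    (ρ : X → Matrix (Fin d) (Fin d) ℂ) (hρ : ∀ x, IsPureState (ρ x))
    (hcover : ∀ ψ : Matrix (Fin d) (Fin d) ℂ, IsPureState ψ →
      η • ψ + ((1 - η) / (d : ℝ)) • (1 : Matrix (Fin d) (Fin d) ℂ) ∈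
        convexHull ℝ (Set.range ρ))
    (hcl : HasClassicalModel A (fun b x y => (Matrix.trace (O y b * ρ x)).re)) :
    ∀ (nZ : ℕ) (σ : Fin nZ → Matrix (Fin d) (Fin d) ℂ),
      (∀ z, IsState (σ z)) →
      HasClassicalModel A (fun b z y => (Matrix.trace (Pi y b * σ z)).re) := by
  intro nZ σ hσ
  refine hcl.of_mixture fun z => ?_
  obtain ⟨ι, _, w, v, hw, hw1, hv, hsum⟩ := mem_convexHull_iff_exists_fintype.1
    ((hσ z).depolarized_mem (convex_convexHull ℝ (Set.range ρ)) hcover)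
  choose f hf using hv
  refine ⟨ι, inferInstance, w, f, hw, hw1, fun b y => ?_⟩
  rw [← trace_inverse_depolarized_mul_depolarized (by omega) hη.1.ne' ((hPi y).2 b) (hσ z).2,
    ← hO, ← hsum]
  simp [Matrix.mul_sum, Matrix.trace_sum, hf]
end
end

section
/- Classical bound of the witness S: let X = {1,2,3,4}, Y = {1,2}, B = {0,1}, and A = {0,1} (a binary message). If a behavior p(b|x,y) admits a classical model with message alphabet A, then, writing E_{xy} = p(0|x,y) − p(1|x,y), the witness S = E₁₁ − E₁₂ − E₂₁ + E₂₂ − E₃₁ − E₃₂ + E₄₁ + E₄₂ satisfies S ≤ 4. -/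
open Matrix BigOperators ComplexOrder

noncomputable section

/-- A bilinear form of CHSH type is at most `4` when `|s|, |t| ≤ 1` and `|d|, |e| ≤ 2`. -/
lemma mul_sub_add_mul_add_le_four {s t d e : ℝ} (hs : |s| ≤ 1) (ht : |t| ≤ 1)
    (hd : |d| ≤ 2) (he : |e| ≤ 2) : s * (d - e) + t * (d + e) ≤ 4 := by
  have h₁ : s * (d - e) ≤ |d - e| := by
    calc s * (d - e) ≤ |s| * |d - e| := by rw [← abs_mul]; exact le_abs_self _
      _ ≤ |d - e| := mul_le_of_le_one_left (abs_nonneg _) hs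
  have h₂ : t * (d + e) ≤ |d + e| := by
    calc t * (d + e) ≤ |t| * |d + e| := by rw [← abs_mul]; exact le_abs_self _
      _ ≤ |d + e| := mul_le_of_le_one_left (abs_nonneg _) ht
  rw [abs_le] at hd he
  rcases abs_cases (d - e) with h | h <;> rcases abs_cases (d + e) with h' | h' <;> linarith

/-- The witness for a fixed value of the shared variable, with encoder `q` and decoder `r`. -/
lemma witness_le_four (q : Fin 2 → Fin 4 → ℝ) (r : Fin 2 → Fin 2 → Fin 2 → ℝ)
    (hq : ∀ a x, 0 ≤ q a x) (hq₁ : ∀ x, ∑ a, q a x = 1)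
    (hr : ∀ b a y, 0 ≤ r b a y) (hr₁ : ∀ a y, ∑ b, r b a y = 1)
    (F : Fin 4 → Fin 2 → ℝ) (hF : ∀ x y, F x y = ∑ a, q a x * (r 0 a y - r 1 a y)) :
    F 0 0 - F 0 1 - F 1 0 + F 1 1 - F 2 0 - F 2 1 + F 3 0 + F 3 1 ≤ 4 := by
  simp only [Fin.sum_univ_two] at hq₁ hr₁ hF
  have hsub : ∀ x x', |q 0 x - q 0 x'| ≤ 1 := fun x x' ↦ by
    rw [abs_le]
    constructor <;> linarith [hq 0 x, hq 1 x, hq 0 x', hq 1 x', hq₁ x, hq₁ x']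
  have hdec : ∀ y, |(r 0 0 y - r 1 0 y) - (r 0 1 y - r 1 1 y)| ≤ 2 := fun y ↦ by
    rw [abs_le]
    constructor <;>
      linarith [hr 0 0 y, hr 1 0 y, hr 0 1 y, hr 1 1 y, hr₁ 0 y, hr₁ 1 y]
  have hq' : ∀ x, q 1 x = 1 - q 0 x := fun x ↦ by linarith [hq₁ x]
  have key := mul_sub_add_mul_add_le_four (hsub 0 1) (hsub 3 2) (hdec 0) (hdec 1)
  simp only [hF, hq']
  linarith

/-- Classical bound of the witness `S`: for `X = {1,2,3,4}`,
`Y = {1,2}`, `B = {0,1}` and a binary message alphabet `A = {0,1}`, every behavior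
admitting a classical model satisfies
`S = E₁₁ - E₁₂ - E₂₁ + E₂₂ - E₃₁ - E₃₂ + E₄₁ + E₄₂ ≤ 4`,
where `E_{xy} = p(0|x,y) - p(1|x,y)`. -/
theorem classical_bound_of_witness
    (p : Fin 2 → Fin 4 → Fin 2 → ℝ)
    (hpos : ∀ b x y, 0 ≤ p b x y) (hnorm : ∀ x y, ∑ b, p b x y = 1)
    (hcl : HasClassicalModel (Fin 2) p)
    (E : Fin 4 → Fin 2 → ℝ) (hE : ∀ x y, E x y = p 0 x y - p 1 x y) :
    E 0 0 - E 0 1 - E 1 0 + E 1 1 - E 2 0 - E 2 1 + E 3 0 + E 3 1 ≤ 4 := by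
  obtain ⟨n, pr, pa, pb, hpr, hpr₁, hpa, hpa₁, hpb, hpb₁, hp⟩ := hcl
  let F : Fin n → Fin 4 → Fin 2 → ℝ :=
    fun l x y ↦ ∑ a, pa a x l * (pb 0 a y l - pb 1 a y l)
  have hEF : ∀ x y, E x y = ∑ l, pr l * F l x y := fun x y ↦ by
    simp only [hE, hp, F, ← Finset.sum_sub_distrib, Finset.mul_sum, mul_sub, mul_assoc]
  have hF : ∀ l, F l 0 0 - F l 0 1 - F l 1 0 + F l 1 1 - F l 2 0 - F l 2 1
      + F l 3 0 + F l 3 1 ≤ 4 := fun l ↦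
    witness_le_four (fun a x ↦ pa a x l) (fun b a y ↦ pb b a y l)
      (fun a x ↦ hpa a x l) (fun x ↦ hpa₁ x l) (fun b a y ↦ hpb b a y l)
      (fun a y ↦ hpb₁ a y l) (F l) fun _ _ ↦ rfl
  calc E 0 0 - E 0 1 - E 1 0 + E 1 1 - E 2 0 - E 2 1 + E 3 0 + E 3 1
      = ∑ l, pr l * (F l 0 0 - F l 0 1 - F l 1 0 + F l 1 1 - F l 2 0 - F l 2 1
          + F l 3 0 + F l 3 1) := by
        simp only [hEF, mul_add, mul_sub, Finset.sum_add_distrib, Finset.sum_sub_distrib]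
    _ ≤ ∑ l, pr l * 4 := Finset.sum_le_sum fun l _ ↦ mul_le_mul_of_nonneg_left (hF l) (hpr l)
    _ = 4 := by rw [← Finset.sum_mul, hpr₁, one_mul]
end
end

section
/- Non-classicality of the activation family: let α ∈ [0,1] and θ ∈ (0, π/2] satisfy α·sinθ > 1/√2. Let ρ₁, ρ₂, ρ₃, ρ₄ be the qubit states with Bloch vectors r₁ = α(−sinθ/√2, cosθ, −sinθ/√2), r₂ = α(sinθ/√2, cosθ, sinθ/√2), r₃ = α(sinθ/√2, cosθ, −sinθ/√2), r₄ = α(−sinθ/√2, cosθ, sinθ/√2), and let the two projective measurements have effects M_{0|y} = (I₂ + q_y·σ)/2, M_{1|y} = I₂ − M_{0|y} with q₁ = (−1,0,0), q₂ = (0,0,1). Then the behavior p(b|x,y) = tr(M_{b|y} ρ_x) does not admit any classical model with binary message alphabet A = {0,1}. -/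
open Matrix BigOperators ComplexOrder

noncomputable section

/-- The Pauli matrix `σ₁`. -/
def pauli1 : Matrix (Fin 2) (Fin 2) ℂ := !![0, 1; 1, 0]

/-- The Pauli matrix `σ₂`. -/
def pauli2 : Matrix (Fin 2) (Fin 2) ℂ := !![0, -Complex.I; Complex.I, 0]

/-- The Pauli matrix `σ₃`. -/
def pauli3 : Matrix (Fin 2) (Fin 2) ℂ := !![1, 0; 0, -1]

/-- `v · σ = v₁σ₁ + v₂σ₂ + v₃σ₃` for a real vector `v ∈ ℝ³`. -/
def blochDot (v : Fin 3 → ℝ) : Matrix (Fin 2) (Fin 2) ℂ :=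
  (v 0 : ℂ) • pauli1 + (v 1 : ℂ) • pauli2 + (v 2 : ℂ) • pauli3

/-- The Bloch vectors `r₁, r₂, r₃, r₄` of the activation family of preparations. -/
def activationBloch (α θ : ℝ) : Fin 4 → Fin 3 → ℝ :=
  ![![-(α * Real.sin θ / Real.sqrt 2), α * Real.cos θ, -(α * Real.sin θ / Real.sqrt 2)],
    ![α * Real.sin θ / Real.sqrt 2, α * Real.cos θ, α * Real.sin θ / Real.sqrt 2],
    ![α * Real.sin θ / Real.sqrt 2, α * Real.cos θ, -(α * Real.sin θ / Real.sqrt 2)],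
    ![-(α * Real.sin θ / Real.sqrt 2), α * Real.cos θ, α * Real.sin θ / Real.sqrt 2]]

/-- The four preparations `ρ_x = (I + r_x·σ)/2` of the activation family. -/
def activationState (α θ : ℝ) (x : Fin 4) : Matrix (Fin 2) (Fin 2) ℂ :=
  (1 / 2 : ℂ) • (1 + blochDot (activationBloch α θ x))

/-- The measurement Bloch vectors `q₁ = (-1,0,0)` and `q₂ = (0,0,1)`. -/
def activationMeasBloch : Fin 2 → Fin 3 → ℝ :=
  ![![-1, 0, 0], ![0, 0, 1]]

/-- The two projective measurements `M_{0|y} = (I + q_y·σ)/2`, `M_{1|y} = I - M_{0|y}`. -/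
def activationEffect (y b : Fin 2) : Matrix (Fin 2) (Fin 2) ℂ :=
  if b = 0 then (1 / 2 : ℂ) • (1 + blochDot (activationMeasBloch y))
  else 1 - (1 / 2 : ℂ) • (1 + blochDot (activationMeasBloch y))

/-- The correlator `E_{xy} = tr (M_{0|y} ρ_x) - tr (M_{1|y} ρ_x)`. -/
def activationCorrelator (α θ : ℝ) (x : Fin 4) (y : Fin 2) : ℝ :=
  (Matrix.trace (activationEffect y 0 * activationState α θ x)).re
    - (Matrix.trace (activationEffect y 1 * activationState α θ x)).re

/-- The first-outcome probabilities of the activation family: the first measurement reads off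
minus the first Bloch component and the second one the third Bloch component. -/
theorem activation_prob_zero (α θ : ℝ) (x : Fin 4) :
    (Matrix.trace (activationEffect 0 0 * activationState α θ x)).re
        = (1 - activationBloch α θ x 0) / 2 ∧
      (Matrix.trace (activationEffect 1 0 * activationState α θ x)).re
        = (1 + activationBloch α θ x 2) / 2 := by
  constructor <;>
  · simp [activationEffect, activationState, blochDot, activationMeasBloch, pauli1, pauli2,
      pauli3, Matrix.trace_fin_two, Matrix.mul_apply, Fin.sum_univ_two]
    ring

/-- A sum of two products with coefficients in `[-1, 1]` of the difference and the sum of two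
numbers in `[-1, 1]` is at most two. -/
theorem mul_sub_add_mul_add_le_two {c c' d d' : ℝ} (hc : |c| ≤ 1) (hc' : |c'| ≤ 1)
    (hd : |d| ≤ 1) (hd' : |d'| ≤ 1) : c * (d - d') + c' * (d + d') ≤ 2 := by
  have h₁ : c * (d - d') ≤ |d - d'| := by
    calc c * (d - d') ≤ |c| * |d - d'| := (le_abs_self _).trans (abs_mul _ _).le
      _ ≤ |d - d'| := mul_le_of_le_one_left (abs_nonneg _) hc
  have h₂ : c' * (d + d') ≤ |d + d'| := by
    calc c' * (d + d') ≤ |c'| * |d + d'| := (le_abs_self _).trans (abs_mul _ _).le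
      _ ≤ |d + d'| := mul_le_of_le_one_left (abs_nonneg _) hc'
  rw [abs_le] at hd hd'
  rcases abs_cases (d - d') with h | h <;> rcases abs_cases (d + d') with h' | h' <;> linarith

/-- The random access code inequality: a behavior with a classical model with binary messages
satisfies the classical bound of the `2 → 1` random access code. -/
theorem HasClassicalModel.random_access_code_le {p : Fin 2 → Fin 4 → Fin 2 → ℝ}
    (hp : HasClassicalModel (Fin 2) p) :
    (p 0 0 0 - p 0 0 1) - (p 0 1 0 - p 0 1 1) - (p 0 2 0 + p 0 2 1) + (p 0 3 0 + p 0 3 1) ≤ 2 := by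
  obtain ⟨n, pr, pa, pb, hpr, hpr1, hpa, hpa1, hpb, hpb1, hp⟩ := hp
  simp only [Fin.sum_univ_two] at hpa1 hpb1 hp
  have pa_diff (x x' : Fin 4) (l : Fin n) : |pa 0 x l - pa 0 x' l| ≤ 1 := by
    rw [abs_le]
    constructor <;> linarith [hpa 0 x l, hpa 1 x l, hpa1 x l, hpa 0 x' l, hpa 1 x' l, hpa1 x' l]
  have pb_diff (y : Fin 2) (l : Fin n) : |pb 0 0 y l - pb 0 1 y l| ≤ 1 := by
    rw [abs_le]
    constructor <;> linarith [hpb 0 0 y l, hpb 1 0 y l, hpb1 0 y l, hpb 0 1 y l, hpb 1 1 y l,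
      hpb1 1 y l]
  calc (p 0 0 0 - p 0 0 1) - (p 0 1 0 - p 0 1 1) - (p 0 2 0 + p 0 2 1) + (p 0 3 0 + p 0 3 1)
      = ∑ l, pr l * ((pa 0 0 l - pa 0 1 l)
            * ((pb 0 0 0 l - pb 0 1 0 l) - (pb 0 0 1 l - pb 0 1 1 l))
          + (pa 0 3 l - pa 0 2 l)
            * ((pb 0 0 0 l - pb 0 1 0 l) + (pb 0 0 1 l - pb 0 1 1 l))) := by
        simp only [hp, ← Finset.sum_add_distrib, ← Finset.sum_sub_distrib]
        refine Finset.sum_congr rfl fun l _ => ?_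
        have pa_one (x : Fin 4) : pa 1 x l = 1 - pa 0 x l := by linarith [hpa1 x l]
        simp only [pa_one]
        ring
    _ ≤ ∑ l, pr l * 2 := Finset.sum_le_sum fun l _ => mul_le_mul_of_nonneg_left
        (mul_sub_add_mul_add_le_two (pa_diff _ _ l) (pa_diff _ _ l) (pb_diff _ l) (pb_diff _ l))
        (hpr l)
    _ = 2 := by rw [← Finset.sum_mul, hpr1, one_mul]

/-- Non-classicality of the activation family: when
`α·sin θ > 1/√2`, the behavior generated by the four activation states under the two
projective measurements admits no classical model with a binary message alphabet. -/
theorem activation_family_nonclassical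
    (α θ : ℝ) (hα : α ∈ Set.Icc (0 : ℝ) 1) (hθ : θ ∈ Set.Ioc 0 (Real.pi / 2))
    (h : 1 / Real.sqrt 2 < α * Real.sin θ) :
    ¬ HasClassicalModel (Fin 2)
        (fun b x y => (Matrix.trace (activationEffect y b * activationState α θ x)).re) := by
  intro hp
  have hle := hp.random_access_code_le
  simp only [(activation_prob_zero α θ _).1, (activation_prob_zero α θ _).2] at hle
  simp [activationBloch] at hle
  have hgt : 1 / 2 < α * Real.sin θ / Real.sqrt 2 := by
    have hsqrt : (0 : ℝ) < Real.sqrt 2 := by positivity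
    calc (1 : ℝ) / 2 = 1 / Real.sqrt 2 / Real.sqrt 2 := by
          rw [div_div, Real.mul_self_sqrt (by norm_num)]
      _ < α * Real.sin θ / Real.sqrt 2 := by gcongr
  linarith
end
end
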